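/- arXiv:1902.00932 — 3 statements merged into one kernel-verified Lean document; each statement's English description precedes it below -/
import Mathlib

section
/- Let 0 → A → B → C → 0 be a short exact sequence of abelian groups in which A and B are mild. Then C is mild, and the following relations hold: r(C) ≤ r(B) ≤ r(A) + r(C); s(A) ≤ s(B) ≤ s(A) + s(C); and r(A) + r(C) − r(B) = s(A) + s(C) − s(B). -/
noncomputable section

universe u v

/-- The abelian group `ℚ/ℤ`. -/
abbrev QmodZ : Type := AddCircle (1 : ℚ)

/-- An abelian group is *uniquely divisible* if every element has a unique `n`-th divisor
for every positive integer `n`. -/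
def IsUniquelyDivisible (V : Type*) [AddCommGroup V] : Prop :=
  ∀ (v : V) (n : ℕ), 0 < n → ∃! w : V, n • w = v

/-- The subgroup of divisible elements of an abelian group. -/
def divisibleSubgroup (G : Type*) [AddCommGroup G] : AddSubgroup G where
  carrier := {g | ∀ n : ℕ, 0 < n → ∃ h : G, n • h = g}
  zero_mem' := fun n _ => ⟨0, smul_zero n⟩
  add_mem' := by
    intro a b ha hb n hn
    obtain ⟨x, hx⟩ := ha n hn
    obtain ⟨y, hy⟩ := hb n hn
    exact ⟨x + y, by rw [smul_add, hx, hy]⟩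
  neg_mem' := by
    intro a ha n hn
    obtain ⟨x, hx⟩ := ha n hn
    exact ⟨-x, by rw [smul_neg, hx]⟩

@[simp] lemma mem_divisibleSubgroup {G : Type*} [AddCommGroup G] (g : G) :
    g ∈ divisibleSubgroup G ↔ ∀ n : ℕ, 0 < n → ∃ h : G, n • h = g := Iff.rfl

/-- The torsion subgroup of an abelian group. -/
def torsionSubgroup (G : Type*) [AddCommGroup G] : AddSubgroup G where
  carrier := {g | ∃ n : ℕ, 0 < n ∧ n • g = 0}
  zero_mem' := ⟨1, Nat.one_pos, smul_zero 1⟩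
  add_mem' := by
    rintro a b ⟨m, hm, ha⟩ ⟨n, hn, hb⟩
    refine ⟨m * n, Nat.mul_pos hm hn, ?_⟩
    have ha' : (m * n) • a = 0 := by rw [mul_comm, mul_smul, ha, smul_zero]
    have hb' : (m * n) • b = 0 := by rw [mul_smul, hb, smul_zero]
    rw [smul_add, ha', hb', add_zero]
  neg_mem' := by
    rintro a ⟨n, hn, ha⟩
    exact ⟨n, hn, by rw [smul_neg, ha, neg_zero]⟩

@[simp] lemma mem_torsionSubgroup {G : Type*} [AddCommGroup G] (g : G) :
    g ∈ torsionSubgroup G ↔ ∃ n : ℕ, 0 < n ∧ n • g = 0 := Iff.rfl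

/-- The subgroup of divisible torsion elements: `G_td = G_tor ⊓ G_div`. -/
def tdSubgroup (G : Type*) [AddCommGroup G] : AddSubgroup G :=
  torsionSubgroup G ⊓ divisibleSubgroup G

/-- `G` is *mild with invariants `s` and `r`* if it is a direct sum of a uniquely divisible
group, `(ℚ/ℤ)^s`, a free abelian group of rank `r`, and a finite abelian group. -/
def IsMildWith (G : Type u) [AddCommGroup G] (s r : ℕ) : Prop :=
  ∃ (V T : Type u) (_ : AddCommGroup V) (_ : AddCommGroup T),
    IsUniquelyDivisible V ∧ Finite T ∧
      Nonempty (G ≃+ V × (Fin s → QmodZ) × (Fin r → ℤ) × T)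

/-- A *mild* abelian group. -/
def IsMild (G : Type u) [AddCommGroup G] : Prop :=
  ∃ s r : ℕ, IsMildWith G s r


open Function

/-- An abelian group is divisible if multiplication by every positive integer is surjective. -/
def IsDivisible (G : Type*) [AddCommGroup G] : Prop :=
  ∀ n : ℕ, 0 < n → Surjective fun x : G => n • x

/-- The subgroup of elements killed by `n`. -/
abbrev torsionOf (G : Type*) [AddCommGroup G] (n : ℕ) : AddSubgroup G :=
  (nsmulAddMonoidHom n : G →+ G).ker

/-- The subgroup of multiples of `n`. -/
abbrev multiplesOf (G : Type*) [AddCommGroup G] (n : ℕ) : AddSubgroup G :=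
  (nsmulAddMonoidHom n : G →+ G).range

lemma mem_torsionOf {G : Type*} [AddCommGroup G] {n : ℕ} {x : G} :
    x ∈ torsionOf G n ↔ n • x = 0 := Iff.rfl

lemma IsDivisible.of_surjective {G H : Type*} [AddCommGroup G] [AddCommGroup H]
    (hG : IsDivisible G) (φ : G →+ H) (hφ : Surjective φ) : IsDivisible H := by
  intro n hn y
  obtain ⟨x, rfl⟩ := hφ y
  obtain ⟨z, rfl⟩ := hG n hn x
  exact ⟨φ z, (map_nsmul φ n z).symm⟩

lemma IsDivisible.prod {G H : Type*} [AddCommGroup G] [AddCommGroup H]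
    (hG : IsDivisible G) (hH : IsDivisible H) : IsDivisible (G × H) := by
  rintro n hn ⟨x, y⟩
  obtain ⟨a, ha⟩ := hG n hn x
  obtain ⟨b, hb⟩ := hH n hn y
  exact ⟨(a, b), Prod.ext ha hb⟩

lemma IsDivisible.pi {ι : Type*} {G : Type*} [AddCommGroup G]
    (hG : IsDivisible G) : IsDivisible (ι → G) := by
  intro n hn x
  choose y hy using fun i => hG n hn (x i)
  exact ⟨y, funext hy⟩

lemma IsUniquelyDivisible.isDivisible {G : Type*} [AddCommGroup G]
    (hG : IsUniquelyDivisible G) : IsDivisible G :=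
  fun n hn x => (hG x n hn).exists

lemma isDivisible_rat : IsDivisible ℚ := fun n hn x =>
  ⟨x / n, by simp only [nsmul_eq_mul]; field_simp⟩

lemma isDivisible_qmodZ : IsDivisible QmodZ :=
  isDivisible_rat.of_surjective (QuotientAddGroup.mk' _) (QuotientAddGroup.mk'_surjective _)

/-- Homomorphisms into divisible groups extend along injections. -/
lemma IsDivisible.exists_extension {Q M N : Type*} [AddCommGroup Q] [AddCommGroup M]
    [AddCommGroup N] (hQ : IsDivisible Q) (i : M →+ N) (hi : Injective i) (φ : M →+ Q) :
    ∃ ψ : N →+ Q, ∀ x, ψ (i x) = φ x := by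
  let _ : DivisibleBy Q ℕ := divisibleByOfSMulRightSurj Q ℕ fun {n} hn =>
    hQ n (Nat.pos_of_ne_zero hn)
  let _ : DivisibleBy Q ℤ := AddGroup.divisibleByIntOfDivisibleByNat Q
  obtain ⟨ψ, hψ⟩ := (Module.Baer.of_divisible Q).extension_property_addMonoidHom i hi φ
  exact ⟨ψ, fun x => DFunLike.congr_fun hψ x⟩

/-- A short exact sequence with divisible kernel splits. -/
lemma IsDivisible.nonempty_addEquiv_prod {E G F : Type*} [AddCommGroup E] [AddCommGroup G]
    [AddCommGroup F] (hE : IsDivisible E) (i : E →+ G) (q : G →+ F) (hi : Injective i)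
    (hq : Surjective q) (h : i.range = q.ker) : Nonempty (G ≃+ E × F) := by
  obtain ⟨ρ, hρ⟩ := hE.exists_extension i hi (AddMonoidHom.id E)
  have hqi (e : E) : q (i e) = 0 := by
    rw [← AddMonoidHom.mem_ker, ← h]; exact ⟨e, rfl⟩
  refine ⟨AddEquiv.ofBijective (ρ.prod q) ⟨?_, ?_⟩⟩
  · rw [injective_iff_map_eq_zero]
    intro x hx
    obtain ⟨h1, h2⟩ := Prod.ext_iff.1 hx
    have hx' : x ∈ i.range := h ▸ (show x ∈ q.ker from h2)
    obtain ⟨e, rfl⟩ := hx'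
    have : e = 0 := by simpa [hρ] using h1
    simp [this]
  · rintro ⟨e, y⟩
    obtain ⟨x, rfl⟩ := hq y
    refine ⟨x + i (e - ρ x), ?_⟩
    simp [hρ, hqi]

lemma card_torsionOf_congr {G H : Type*} [AddCommGroup G] [AddCommGroup H] (e : G ≃+ H) (n : ℕ) :
    Nat.card (torsionOf G n) = Nat.card (torsionOf H n) := by
  refine Nat.card_congr (e.toEquiv.subtypeEquiv fun x => ?_)
  change n • x = 0 ↔ n • e x = 0
  rw [← map_nsmul, map_eq_zero_iff e e.injective]

lemma card_torsionOf_prod (G H : Type*) [AddCommGroup G] [AddCommGroup H] (n : ℕ) :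
    Nat.card (torsionOf (G × H) n) = Nat.card (torsionOf G n) * Nat.card (torsionOf H n) := by
  rw [← Nat.card_prod]
  refine Nat.card_congr ⟨fun x => (⟨x.1.1, congrArg Prod.fst x.2⟩, ⟨x.1.2, congrArg Prod.snd x.2⟩),
    fun x => ⟨(x.1.1, x.2.1), Prod.ext x.1.2 x.2.2⟩, fun _ => rfl, fun _ => rfl⟩

lemma card_torsionOf_eq_one {G : Type*} [AddCommGroup G] {n : ℕ}
    (h : ∀ x : G, n • x = 0 → x = 0) : Nat.card (torsionOf G n) = 1 := by
  rw [AddSubgroup.card_eq_one, eq_bot_iff]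
  exact fun x hx => h x hx

lemma index_multiplesOf_congr {G H : Type*} [AddCommGroup G] [AddCommGroup H] (e : G ≃+ H)
    (n : ℕ) : (multiplesOf G n).index = (multiplesOf H n).index := by
  rw [← AddSubgroup.index_map_equiv (multiplesOf G n) e]
  congr 1
  ext x
  constructor
  · rintro ⟨_, ⟨y, rfl⟩, rfl⟩
    exact ⟨e y, (map_nsmul e n y).symm⟩
  · rintro ⟨y, rfl⟩
    refine ⟨n • e.symm y, ⟨e.symm y, rfl⟩, ?_⟩
    simp

lemma index_multiplesOf_prod (G H : Type*) [AddCommGroup G] [AddCommGroup H] (n : ℕ) :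
    (multiplesOf (G × H) n).index = (multiplesOf G n).index * (multiplesOf H n).index := by
  rw [← AddSubgroup.index_prod]
  congr 1
  ext ⟨x, y⟩
  constructor
  · rintro ⟨⟨a, b⟩, h⟩
    obtain ⟨h1, h2⟩ := Prod.ext_iff.1 h
    exact ⟨⟨a, h1⟩, ⟨b, h2⟩⟩
  · rintro ⟨⟨a, h1⟩, ⟨b, h2⟩⟩
    exact ⟨(a, b), Prod.ext h1 h2⟩

lemma IsDivisible.index_multiplesOf {G : Type*} [AddCommGroup G] (hG : IsDivisible G) {n : ℕ}
    (hn : 0 < n) : (multiplesOf G n).index = 1 := by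
  rw [AddSubgroup.index_eq_one, AddMonoidHom.range_eq_top]
  exact hG n hn

lemma index_multiplesOf_int_pi (r n : ℕ) : (multiplesOf (Fin r → ℤ) n).index = n ^ r := by
  let φ : (Fin r → ℤ) →+ (Fin r → ZMod n) :=
    { toFun := fun x i => (x i : ZMod n)
      map_zero' := by ext; simp
      map_add' := fun x y => by ext; simp }
  have hφ : Surjective φ := fun y =>
    ⟨fun i => (ZMod.intCast_surjective (y i)).choose,
      funext fun i => (ZMod.intCast_surjective (y i)).choose_spec⟩
  have hker : multiplesOf (Fin r → ℤ) n = φ.ker := by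
    ext x
    constructor
    · rintro ⟨y, rfl⟩
      ext i
      simp [φ]
    · intro hx
      have hx' (i : Fin r) : (n : ℤ) ∣ x i :=
        (ZMod.intCast_zmod_eq_zero_iff_dvd (x i) n).1 (congrFun hx i)
      choose y hy using hx'
      refine ⟨y, ?_⟩
      ext i
      exact (nsmul_eq_mul _ _).trans (hy i).symm
  rw [hker, AddSubgroup.index_ker, AddMonoidHom.range_eq_top.2 hφ, AddSubgroup.card_top]
  simp [Nat.card_fun]

lemma index_multiplesOf_eq_card_torsionOf (T : Type*) [AddCommGroup T] [Finite T] (n : ℕ) :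
    (multiplesOf T n).index = Nat.card (torsionOf T n) := by
  have h1 := AddSubgroup.card_mul_index (torsionOf T n)
  have h2 := AddSubgroup.card_mul_index (multiplesOf T n)
  rw [AddSubgroup.index_ker, mul_comm, ← h2] at h1
  exact (Nat.eq_of_mul_eq_mul_left Nat.card_pos h1).symm

/-- The counting consequence of the snake lemma for multiplication by `n` on an exact sequence
`0 → K → E → Q → 0` with `E` divisible. -/
lemma card_torsionOf_mul_card_torsionOf {K E Q : Type*} [AddCommGroup K] [AddCommGroup E]
    [AddCommGroup Q] (hE : IsDivisible E) (k : K →+ E) (q : E →+ Q) (hk : Injective k)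
    (hq : Surjective q) (h : k.range = q.ker) {n : ℕ} (hn : 0 < n) :
    Nat.card (torsionOf Q n) * Nat.card (torsionOf K n) =
      Nat.card (torsionOf E n) * (multiplesOf K n).index := by
  set m : E →+ E := nsmulAddMonoidHom n
  have hm : Surjective m := hE n hn
  have hkq (z : K) : k z ∈ q.ker := h ▸ ⟨z, rfl⟩
  set K' : AddSubgroup E := q.ker
  have hle : K' ≤ K' ⊔ m.ker := le_sup_left
  have hK' : (K'.map m).comap m = K' ⊔ m.ker := AddSubgroup.comap_map_eq m K'
  have hKm : K'.map m ≤ K' := by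
    rintro _ ⟨x, hx, rfl⟩
    exact K'.nsmul_mem hx n
  have hle' : K' ⊔ m.ker ≤ K'.comap m := hK' ▸ AddSubgroup.comap_mono hKm
  have h1 := AddSubgroup.relIndex_mul_relIndex K' _ _ hle hle'
  have h2 : K'.relIndex (K'.comap m) = Nat.card (torsionOf Q n) := by
    have : K'.comap m = (torsionOf Q n).comap q := by
      ext x
      simp [K', m, AddMonoidHom.mem_ker]
    rw [this, AddSubgroup.relIndex_ker, AddSubgroup.map_comap_eq_self_of_surjective hq]
  have h3 : (K' ⊔ m.ker).relIndex (K'.comap m) = (multiplesOf K n).index := by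
    rw [← hK', AddSubgroup.relIndex_comap, AddSubgroup.map_comap_eq_self_of_surjective hm]
    have : K'.map m = (multiplesOf K n).map k := by
      ext x
      constructor
      · rintro ⟨y, hy, rfl⟩
        obtain ⟨z, rfl⟩ : y ∈ k.range := h ▸ hy
        exact ⟨n • z, ⟨z, rfl⟩, map_nsmul k n z⟩
      · rintro ⟨_, ⟨z, rfl⟩, rfl⟩
        exact ⟨k z, hkq z, (map_nsmul k n z).symm⟩
    rw [this, show K' = (⊤ : AddSubgroup K).map k by rw [← AddMonoidHom.range_eq_map, h],
      AddSubgroup.relIndex_map_map_of_injective _ _ hk, AddSubgroup.relIndex_top_right]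
  have h4 : K'.relIndex (K' ⊔ m.ker) * Nat.card (torsionOf K n) = Nat.card (torsionOf E n) := by
    have h5 := AddSubgroup.relIndex_mul_relIndex ⊥ (K' ⊓ m.ker) m.ker bot_le inf_le_right
    rw [AddSubgroup.relIndex_bot_left, AddSubgroup.relIndex_bot_left,
      AddSubgroup.inf_relIndex_right] at h5
    have h6 : K' ⊓ m.ker = (torsionOf K n).map k := by
      ext x
      constructor
      · rintro ⟨hx, hx'⟩
        obtain ⟨z, rfl⟩ : x ∈ k.range := h ▸ hx
        refine ⟨z, ?_, rfl⟩
        apply hk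
        rw [map_zero]
        exact (map_nsmul k n z).trans hx'
      · rintro ⟨z, hz, rfl⟩
        refine ⟨hkq z, ?_⟩
        change n • k z = 0
        rw [← map_nsmul, mem_torsionOf.1 hz, map_zero]
    rw [AddSubgroup.relIndex_sup_left, mul_comm, ← h5, h6, AddSubgroup.card_map_of_injective hk]
  rw [← h2, ← h1, h3, ← h4]
  ring

lemma card_torsionOf_qmodZ_pi (s : ℕ) {n : ℕ} (hn : 0 < n) :
    Nat.card (torsionOf (Fin s → QmodZ) n) = n ^ s := by
  let k : (Fin s → ℤ) →+ (Fin s → ℚ) :=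
    { toFun := fun x i => (x i : ℚ)
      map_zero' := by ext; simp
      map_add' := fun x y => by ext; simp }
  let q : (Fin s → ℚ) →+ (Fin s → QmodZ) :=
    { toFun := fun x i => (x i : QmodZ)
      map_zero' := by ext; simp
      map_add' := fun x y => by ext; simp }
  have hk : Injective k := fun x y h => funext fun i => Int.cast_injective (congrFun h i)
  have hq : Surjective q := fun y =>
    ⟨fun i => (QuotientAddGroup.mk_surjective (y i)).choose,
      funext fun i => (QuotientAddGroup.mk_surjective (y i)).choose_spec⟩
  have h : k.range = q.ker := by
    ext x
    have (i : Fin s) : ((x i : QmodZ) = 0) ↔ ∃ z : ℤ, (z : ℚ) = x i := by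
      rw [AddCircle.coe_eq_zero_iff]; simp
    constructor
    · rintro ⟨y, rfl⟩
      ext i
      exact congrFun (f := q (k y)) (g := 0) (funext fun i => (this i).2 ⟨y i, rfl⟩) i
    · intro hx
      choose y hy using fun i => (this i).1 (congrFun hx i)
      exact ⟨y, funext hy⟩
  have := card_torsionOf_mul_card_torsionOf isDivisible_rat.pi k q hk hq h hn
  rw [card_torsionOf_eq_one (G := Fin s → ℤ) fun x hx => ?_,
    card_torsionOf_eq_one (G := Fin s → ℚ) fun x hx => ?_,
    index_multiplesOf_int_pi] at this
  · rwa [mul_one, one_mul] at this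
  · exact (smul_eq_zero.1 hx).resolve_left hn.ne'
  · exact (smul_eq_zero.1 hx).resolve_left hn.ne'

lemma nonempty_addEquiv_torsionOf {G H : Type*} [AddCommGroup G] [AddCommGroup H] {p s : ℕ}
    (hp : p.Prime) (hG : Nat.card (torsionOf G p) = p ^ s)
    (hH : Nat.card (torsionOf H p) = p ^ s) : Nonempty (torsionOf G p ≃+ torsionOf H p) := by
  have : Fact p.Prime := ⟨hp⟩
  have hpos : p ^ s ≠ 0 := pow_ne_zero _ hp.ne_zero
  have : Finite (torsionOf G p) := Nat.finite_of_card_ne_zero (hG ▸ hpos)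
  have : Finite (torsionOf H p) := Nat.finite_of_card_ne_zero (hH ▸ hpos)
  have : Module (ZMod p) (torsionOf G p) := AddCommGroup.zmodModule fun x => Subtype.ext x.2
  have : Module (ZMod p) (torsionOf H p) := AddCommGroup.zmodModule fun x => Subtype.ext x.2
  have h1 := FiniteField.pow_finrank_eq_natCard p (torsionOf G p)
  have h2 := FiniteField.pow_finrank_eq_natCard p (torsionOf H p)
  rw [hG] at h1
  rw [hH, ← h1] at h2
  let e : torsionOf G p ≃ₗ[ZMod p] torsionOf H p :=
    LinearEquiv.ofFinrankEq _ _ (Nat.pow_right_injective hp.two_le h2.symm)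
  exact ⟨e.toAddEquiv⟩

/-- The subgroups of elements killed by distinct primes are independent. -/
lemma iSupIndep_torsionOf (G : Type*) [AddCommGroup G] :
    iSupIndep fun p : Nat.Primes => torsionOf G p := by
  intro p
  rw [disjoint_iff_inf_le]
  rintro x ⟨hx, hx'⟩
  let S : AddSubgroup G :=
    { carrier := {y | ∃ m : ℕ, m.Coprime p ∧ m • y = 0}
      zero_mem' := ⟨1, Nat.coprime_one_left _, smul_zero _⟩
      add_mem' := by
        rintro a b ⟨m, hm, ha⟩ ⟨n, hn, hb⟩
        refine ⟨m * n, hm.mul_left hn, ?_⟩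
        rw [smul_add, mul_smul m n b, hb, mul_comm, mul_smul, ha, smul_zero, smul_zero, add_zero]
      neg_mem' := by
        rintro a ⟨m, hm, ha⟩
        exact ⟨m, hm, by rw [smul_neg, ha, neg_zero]⟩ }
  have hS : (⨆ (q : Nat.Primes) (_ : q ≠ p), torsionOf G q) ≤ S :=
    iSup₂_le fun q hq y hy =>
      ⟨q, (Nat.coprime_primes q.2 p.2).2 fun h => hq (Subtype.ext h), hy⟩
  obtain ⟨m, hm, hmx⟩ := hS hx'
  have h1 : addOrderOf x ∣ 1 := by
    rw [← hm]
    exact Nat.dvd_gcd (addOrderOf_dvd_of_nsmul_eq_zero hmx) (addOrderOf_dvd_of_nsmul_eq_zero hx)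
  exact AddMonoid.addOrderOf_eq_one_iff.1 (Nat.dvd_one.1 h1)

/-- A homomorphism from a torsion group is injective if it is injective on each
`torsionOf G p`. -/
lemma injective_of_injOn_torsionOf {G H : Type*} [AddCommGroup G] [AddCommGroup H]
    (hG : ∀ x : G, ∃ n : ℕ, 0 < n ∧ n • x = 0) (φ : G →+ H)
    (h : ∀ p : ℕ, p.Prime → ∀ x ∈ torsionOf G p, φ x = 0 → x = 0) : Injective φ := by
  rw [injective_iff_map_eq_zero]
  intro x hx
  obtain ⟨n, hn, hnx⟩ := hG x
  induction n using Nat.strong_induction_on generalizing x with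
  | _ n ih =>
    obtain rfl | hn1 := eq_or_ne n 1
    · simpa using hnx
    obtain ⟨p, hp, m, rfl⟩ := Nat.exists_prime_and_dvd hn1
    have hm : 0 < m := Nat.pos_of_mul_pos_left hn
    refine h p hp x ?_ hx
    refine ih m (lt_mul_of_one_lt_left hm hp.one_lt) (p • x) ?_ hm ?_
    · rw [map_nsmul, hx, smul_zero]
    · rw [← mul_smul, mul_comm, hnx]

lemma surjective_of_torsionOf_le_range {G H : Type*} [AddCommGroup G] [AddCommGroup H]
    (hG : IsDivisible G) (hH : ∀ x : H, ∃ n : ℕ, 0 < n ∧ n • x = 0) (φ : G →+ H)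
    (h : ∀ p : ℕ, p.Prime → torsionOf H p ≤ φ.range) : Surjective φ := by
  intro y
  obtain ⟨n, hn, hny⟩ := hH y
  induction n using Nat.strong_induction_on generalizing y with
  | _ n ih =>
    obtain rfl | hn1 := eq_or_ne n 1
    · exact ⟨0, by simpa using hny.symm⟩
    obtain ⟨p, hp, m, rfl⟩ := Nat.exists_prime_and_dvd hn1
    have hm : 0 < m := Nat.pos_of_mul_pos_left hn
    obtain ⟨x, hx⟩ := ih m (lt_mul_of_one_lt_left hm hp.one_lt) (p • y) hm
      (by rw [← mul_smul, mul_comm, hny])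
    obtain ⟨z, rfl⟩ := hG p hp.pos x
    obtain ⟨w, hw⟩ := h p hp (show y - φ z ∈ torsionOf H p by
      rw [mem_torsionOf, smul_sub, ← map_nsmul, hx, sub_self])
    exact ⟨w + z, by rw [map_add, hw, sub_add_cancel]⟩

/-- Divisible torsion groups are determined by the orders of their `p`-socles. -/
lemma nonempty_addEquiv_of_card_torsionOf {G H : Type*} [AddCommGroup G] [AddCommGroup H] {s : ℕ}
    (hG : IsDivisible G) (hH : IsDivisible H)
    (hGt : ∀ x : G, ∃ n : ℕ, 0 < n ∧ n • x = 0) (hHt : ∀ x : H, ∃ n : ℕ, 0 < n ∧ n • x = 0)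
    (hGs : ∀ p : ℕ, p.Prime → Nat.card (torsionOf G p) = p ^ s)
    (hHs : ∀ p : ℕ, p.Prime → Nat.card (torsionOf H p) = p ^ s) : Nonempty (G ≃+ H) := by
  classical
  have e (p : Nat.Primes) : torsionOf G p ≃+ torsionOf H p :=
    (nonempty_addEquiv_torsionOf p.2 (hGs p p.2) (hHs p p.2)).some
  let i : (Π₀ p : Nat.Primes, torsionOf G p) →+ G :=
    DFinsupp.sumAddHom fun p => (torsionOf G p).subtype
  let φ : (Π₀ p : Nat.Primes, torsionOf G p) →+ H :=
    DFinsupp.sumAddHom fun p => (torsionOf H p).subtype.comp (e p).toAddMonoidHom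
  obtain ⟨ψ, hψ⟩ := hH.exists_extension i
    (iSupIndep_torsionOf G).dfinsuppSumAddHom_injective φ
  have hψe (p : Nat.Primes) (x : torsionOf G p) : ψ x = e p x := by
    simpa [i, φ] using hψ (DFinsupp.single p x)
  refine ⟨AddEquiv.ofBijective ψ ⟨?_, ?_⟩⟩
  · refine injective_of_injOn_torsionOf hGt ψ fun p hp x hx h0 => ?_
    have h1 := hψe ⟨p, hp⟩ ⟨x, hx⟩
    rw [h0] at h1
    have h2 : e ⟨p, hp⟩ ⟨x, hx⟩ = 0 := Subtype.ext h1.symm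
    exact congrArg Subtype.val ((map_eq_zero_iff _ (e ⟨p, hp⟩).injective).1 h2)
  · refine surjective_of_torsionOf_le_range hG hHt ψ fun p hp y hy => ?_
    refine ⟨(e ⟨p, hp⟩).symm ⟨y, hy⟩, ?_⟩
    rw [hψe ⟨p, hp⟩, AddEquiv.apply_symm_apply]

lemma exists_nsmul_eq_zero_qmodZ_pi (s : ℕ) (x : Fin s → QmodZ) :
    ∃ n : ℕ, 0 < n ∧ n • x = 0 := by
  have h (y : QmodZ) : ∃ n : ℕ, 0 < n ∧ n • y = 0 := by
    obtain ⟨a, rfl⟩ := QuotientAddGroup.mk_surjective y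
    refine ⟨a.den, a.den_pos, ?_⟩
    change ((a.den • a : ℚ) : QmodZ) = 0
    rw [AddCircle.coe_eq_zero_iff]
    exact ⟨a.num, by rw [nsmul_eq_mul, mul_comm, Rat.mul_den_eq_num]; simp⟩
  choose n hn hnx using fun i => h (x i)
  refine ⟨∏ i, n i, Finset.prod_pos fun i _ => hn i, funext fun i => ?_⟩
  rw [Pi.smul_apply, ← Finset.prod_erase_mul _ _ (Finset.mem_univ i), mul_smul, hnx, smul_zero,
    Pi.zero_apply]

/-- A divisible group whose `p`-socles all have order `p ^ s` is the sum of a uniquely divisible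
group and `(ℚ/ℤ)^s`. -/
lemma IsDivisible.exists_addEquiv {E : Type u} [AddCommGroup E] (hE : IsDivisible E) {s : ℕ}
    (hs : ∀ p : ℕ, p.Prime → Nat.card (torsionOf E p) = p ^ s) :
    ∃ (V : Type u) (_ : AddCommGroup V), IsUniquelyDivisible V ∧
      Nonempty (E ≃+ V × (Fin s → QmodZ)) := by
  set t := torsionSubgroup E
  have ht : IsDivisible t := by
    rintro n hn ⟨x, m, hm, hx⟩
    obtain ⟨y, rfl⟩ := hE n hn x
    exact ⟨⟨y, m * n, Nat.mul_pos hm hn, by rw [mul_smul]; exact hx⟩, rfl⟩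
  have htt (x : t) : ∃ n : ℕ, 0 < n ∧ n • x = 0 := by
    obtain ⟨x, m, hm, hx⟩ := x
    exact ⟨m, hm, Subtype.ext hx⟩
  have hts (p : ℕ) (hp : p.Prime) : Nat.card (torsionOf t p) = p ^ s := by
    rw [← hs p hp]
    exact Nat.card_congr ⟨fun x => ⟨x.1, congrArg Subtype.val x.2⟩,
      fun x => ⟨⟨x, p, hp.pos, x.2⟩, Subtype.ext x.2⟩, fun _ => rfl, fun _ => rfl⟩
  obtain ⟨e₁⟩ := nonempty_addEquiv_of_card_torsionOf ht (isDivisible_qmodZ.pi (ι := Fin s)) htt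
    (exists_nsmul_eq_zero_qmodZ_pi s) hts fun p hp => card_torsionOf_qmodZ_pi s hp.pos
  obtain ⟨e₂⟩ := ht.nonempty_addEquiv_prod t.subtype (QuotientAddGroup.mk' t)
    t.subtype_injective (QuotientAddGroup.mk'_surjective t) (by simp)
  refine ⟨E ⧸ t, inferInstance, fun v n hn => ?_,
    ⟨(e₂.trans (e₁.prodCongr (AddEquiv.refl _))).trans AddEquiv.prodComm⟩⟩
  refine existsUnique_of_exists_of_unique
    (hE.of_surjective _ (QuotientAddGroup.mk'_surjective t) n hn v) fun a b ha hb => ?_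
  obtain ⟨x, hx⟩ := QuotientAddGroup.mk_surjective (a - b)
  have h0 : n • (a - b) = 0 := by rw [smul_sub, ha, hb, sub_self]
  rw [← hx, ← QuotientAddGroup.mk_nsmul, QuotientAddGroup.eq_zero_iff] at h0
  obtain ⟨m, hm, h⟩ := h0
  rw [← sub_eq_zero, ← hx, QuotientAddGroup.eq_zero_iff]
  exact ⟨m * n, Nat.mul_pos hm hn, by rw [mul_smul, h]⟩

lemma finrank_range_add_finrank_ker_int {M N : Type*} [AddCommGroup M] [AddCommGroup N]
    [Module.Finite ℤ M] (φ : M →ₗ[ℤ] N) :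
    Module.finrank ℤ φ.range + Module.finrank ℤ φ.ker = Module.finrank ℤ M := by
  rw [← φ.quotKerEquivRange.finrank_eq, Submodule.finrank_quotient_add_finrank]

lemma finrank_int_pi_prod (r : ℕ) (T : Type*) [AddCommGroup T] [Finite T] :
    Module.finrank ℤ ((Fin r → ℤ) × T) = r := by
  have h := finrank_range_add_finrank_ker_int (LinearMap.fst ℤ (Fin r → ℤ) T)
  have h0 : Module.finrank ℤ (LinearMap.fst ℤ (Fin r → ℤ) T).ker = 0 := by
    rw [LinearMap.ker_fst, LinearMap.finrank_range_of_inj LinearMap.inr_injective]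
    refine Module.finrank_eq_zero_iff.2 fun x => ⟨addOrderOf x, ?_, ?_⟩
    · exact_mod_cast (addOrderOf_pos x).ne'
    · rw [natCast_zsmul, addOrderOf_nsmul_eq_zero]
  rw [← h, h0, LinearMap.range_eq_top.2 LinearMap.fst_surjective, finrank_top]
  simp

/-- Finitely generated abelian groups are sums of a free group of the right rank and a finite
group. -/
lemma exists_addEquiv_of_finite (F : Type u) [AddCommGroup F] [Module.Finite ℤ F] :
    ∃ (T : Type u) (_ : AddCommGroup T), Finite T ∧
      Nonempty (F ≃+ (Fin (Module.finrank ℤ F) → ℤ) × T) := by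
  have : AddGroup.FG F := Module.Finite.iff_addGroup_fg.1 inferInstance
  obtain ⟨n, ι, _, p, hp, e, ⟨φ⟩⟩ := AddCommGroup.equiv_free_prod_directSum_zmod F
  classical
  have (i : ι) : NeZero (p i ^ e i) := ⟨pow_ne_zero _ (hp i).ne_zero⟩
  have : Finite (DirectSum ι fun i => ZMod (p i ^ e i)) :=
    Finite.of_equiv _ (DirectSum.addEquivProd fun i => ZMod (p i ^ e i)).symm.toEquiv
  let T := ULift.{u} (DirectSum ι fun i => ZMod (p i ^ e i))
  have ψ : F ≃+ (Fin n → ℤ) × T := φ.trans <|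
    (Finsupp.linearEquivFunOnFinite ℤ ℤ (Fin n)).toAddEquiv.prodCongr AddEquiv.ulift.symm
  have hT : Finite T := inferInstance
  have hn : Module.finrank ℤ F = n := by
    rw [ψ.toIntLinearEquiv.finrank_eq, finrank_int_pi_prod]
  exact ⟨T, inferInstance, hT, hn ▸ ⟨ψ⟩⟩

lemma eq_zero_of_divisible_int_pi_prod {r : ℕ} {T : Type*} [AddCommGroup T] [Finite T]
    (x : (Fin r → ℤ) × T) (hx : x ∈ divisibleSubgroup ((Fin r → ℤ) × T)) : x = 0 := by
  refine Prod.ext (funext fun i => ?_) ?_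
  · obtain ⟨y, hy⟩ := hx ((x.1 i).natAbs + 1) (Nat.succ_pos _)
    have h1 : (((x.1 i).natAbs + 1 : ℕ) : ℤ) ∣ x.1 i :=
      ⟨y.1 i, by rw [← nsmul_eq_mul]; exact (congrFun (congrArg Prod.fst hy) i).symm⟩
    exact Int.eq_zero_of_abs_lt_dvd h1 (by rw [Int.abs_eq_natAbs]; push_cast; omega)
  · obtain ⟨y, hy⟩ := hx (Nat.card T) Nat.card_pos
    rw [← hy, Prod.smul_snd, card_nsmul_eq_zero', Prod.snd_zero]

/-- A mild group is the sum of a divisible group and a finitely generated one. -/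
lemma IsMildWith.exists_addEquiv {G : Type u} [AddCommGroup G] {s r : ℕ} (h : IsMildWith G s r) :
    ∃ (E F : Type u) (_ : AddCommGroup E) (_ : AddCommGroup F), IsDivisible E ∧
      (∀ p : ℕ, p.Prime → Nat.card (torsionOf E p) = p ^ s) ∧ Module.Finite ℤ F ∧
      Module.finrank ℤ F = r ∧ (∀ x : F, x ∈ divisibleSubgroup F → x = 0) ∧
      Nonempty (G ≃+ E × F) := by
  obtain ⟨V, T, _, _, hV, hT, ⟨e⟩⟩ := h
  refine ⟨V × (Fin s → QmodZ), (Fin r → ℤ) × T, inferInstance, inferInstance,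
    hV.isDivisible.prod isDivisible_qmodZ.pi, fun p hp => ?_, ?_, finrank_int_pi_prod r T,
    eq_zero_of_divisible_int_pi_prod, ⟨e.trans AddEquiv.prodAssoc.symm⟩⟩
  · rw [card_torsionOf_prod, card_torsionOf_qmodZ_pi s hp.pos, card_torsionOf_eq_one, one_mul]
    exact fun x hx => (hV 0 p hp.pos).unique hx (smul_zero p)
  · have : Module.Finite ℤ T := Module.Finite.of_finite
    infer_instance

lemma IsDivisible.isMildWith {G E F : Type u} [AddCommGroup G] [AddCommGroup E] [AddCommGroup F]
    [Module.Finite ℤ F] (hE : IsDivisible E) {s : ℕ}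
    (hs : ∀ p : ℕ, p.Prime → Nat.card (torsionOf E p) = p ^ s) (e : G ≃+ E × F) :
    IsMildWith G s (Module.finrank ℤ F) := by
  obtain ⟨V, _, hV, ⟨e₁⟩⟩ := hE.exists_addEquiv hs
  obtain ⟨T, _, hT, ⟨e₂⟩⟩ := exists_addEquiv_of_finite F
  exact ⟨V, T, _, _, hV, hT, ⟨(e.trans (e₁.prodCongr e₂)).trans AddEquiv.prodAssoc⟩⟩

/-- The Herbrand quotient of multiplication by `p` on the sum of a divisible group and a finitely
generated group. -/
lemma IsDivisible.index_multiplesOf_prod_mul {E : Type*} {F : Type u} [AddCommGroup E]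
    [AddCommGroup F] [Module.Finite ℤ F] (hE : IsDivisible E) {p s : ℕ} (hp : 0 < p)
    (hs : Nat.card (torsionOf E p) = p ^ s) :
    (multiplesOf (E × F) p).index * p ^ s =
        p ^ Module.finrank ℤ F * Nat.card (torsionOf (E × F) p) ∧
      Nat.card (torsionOf (E × F) p) ≠ 0 := by
  obtain ⟨T, _, hT, ⟨e⟩⟩ := exists_addEquiv_of_finite F
  rw [index_multiplesOf_prod, hE.index_multiplesOf hp, index_multiplesOf_congr e,
    index_multiplesOf_prod, index_multiplesOf_int_pi, index_multiplesOf_eq_card_torsionOf,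
    card_torsionOf_prod, hs, card_torsionOf_congr e, card_torsionOf_prod,
    card_torsionOf_eq_one (G := Fin _ → ℤ) fun x hx => (smul_eq_zero.1 hx).resolve_left hp.ne']
  refine ⟨by ring, ?_⟩
  have : Nat.card (torsionOf T p) ≠ 0 := Nat.card_pos.ne'
  positivity

lemma card_torsionOf_le_of_injective {G H : Type*} [AddCommGroup G] [AddCommGroup H] (φ : G →+ H)
    (hφ : Injective φ) {n : ℕ} (h : Nat.card (torsionOf H n) ≠ 0) :
    Nat.card (torsionOf G n) ≤ Nat.card (torsionOf H n) := by
  have : Finite (torsionOf H n) := Nat.finite_of_card_ne_zero h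
  refine Nat.card_le_card_of_injective
    (fun x => ⟨φ x, by rw [mem_torsionOf, ← map_nsmul, mem_torsionOf.1 x.2, map_zero]⟩)
    fun x y hxy => Subtype.ext (hφ (congrArg Subtype.val hxy))

lemma exists_isMildWith_of_decomposition {E₁ F₁ E₂ F₂ C : Type u} [AddCommGroup E₁]
    [AddCommGroup F₁] [AddCommGroup E₂] [AddCommGroup F₂] [AddCommGroup C] [Module.Finite ℤ F₁]
    [Module.Finite ℤ F₂] (hE₁ : IsDivisible E₁) (hE₂ : IsDivisible E₂) {s₁ s₂ : ℕ}
    (hs₁ : ∀ p : ℕ, p.Prime → Nat.card (torsionOf E₁ p) = p ^ s₁)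
    (hs₂ : ∀ p : ℕ, p.Prime → Nat.card (torsionOf E₂ p) = p ^ s₂)
    (hF₂ : ∀ x : F₂, x ∈ divisibleSubgroup F₂ → x = 0)
    (f : E₁ × F₁ →+ E₂ × F₂) (g : E₂ × F₂ →+ C) (hf : Injective f) (hg : Surjective g)
    (hex : f.range = g.ker) :
    ∃ s r t j : ℕ, IsMildWith C s r ∧ s₁ ≤ s₂ ∧ s + s₁ = s₂ + t ∧
      Module.finrank ℤ F₁ = j + t ∧ Module.finrank ℤ F₂ = r + j := by
  have hmem (x : E₂ × F₂) : g x = 0 ↔ ∃ y, f y = x := by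
    rw [← AddMonoidHom.mem_ker, ← hex]; rfl
  have hf0 (e : E₁) : (f (e, 0)).2 = 0 := by
    refine hF₂ _ fun n hn => ?_
    obtain ⟨y, rfl⟩ := hE₁ n hn e
    refine ⟨(f (y, 0)).2, ?_⟩
    rw [← Prod.smul_snd, ← map_nsmul, Prod.smul_mk, smul_zero]
  let j : F₁ →ₗ[ℤ] F₂ :=
    ((AddMonoidHom.snd E₂ F₂).comp (f.comp (AddMonoidHom.inr E₁ F₁))).toIntLinearMap
  have hj (e : E₁) (y : F₁) : (f (e, y)).2 = j y := by
    have : ((e, y) : E₁ × F₁) = (e, 0) + (0, y) := by simp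
    rw [this, map_add, Prod.snd_add, hf0, zero_add]
    rfl
  let α : E₁ →+ E₂ := (AddMonoidHom.fst E₂ F₂).comp (f.comp (AddMonoidHom.inl E₁ F₁))
  have hα : Injective α := by
    rw [injective_iff_map_eq_zero]
    intro e he
    have : f (e, 0) = 0 := Prod.ext he (hf0 e)
    exact congrArg Prod.fst ((map_eq_zero_iff f hf).1 this)
  have hs : s₁ ≤ s₂ := by
    have := card_torsionOf_le_of_injective α hα (n := 2) (by rw [hs₂ 2 Nat.prime_two]; positivity)
    rw [hs₁ 2 Nat.prime_two, hs₂ 2 Nat.prime_two] at this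
    exact (Nat.pow_le_pow_iff_right one_lt_two).1 this
  let k : E₁ × j.ker →+ E₂ := (AddMonoidHom.fst E₂ F₂).comp
    (f.comp ((AddMonoidHom.id E₁).prodMap j.ker.subtype.toAddMonoidHom))
  have hfk (x : E₁ × j.ker) : f (x.1, x.2) = (k x, 0) :=
    Prod.ext rfl ((hj _ _).trans x.2.2)
  have hk : Injective k := by
    rw [injective_iff_map_eq_zero]
    intro x hx
    have h0 := hfk x
    rw [hx] at h0
    obtain ⟨h1, h2⟩ := Prod.ext_iff.1 ((map_eq_zero_iff f hf).1 h0)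
    exact Prod.ext h1 (Subtype.ext h2)
  let γ : E₂ →+ C := g.comp (AddMonoidHom.inl E₂ F₂)
  have hkγ : k.range = γ.rangeRestrict.ker := by
    ext x
    rw [AddMonoidHom.ker_rangeRestrict, AddMonoidHom.mem_ker]
    change (∃ y, k y = x) ↔ g (x, 0) = 0
    rw [hmem]
    constructor
    · rintro ⟨y, rfl⟩
      exact ⟨_, hfk y⟩
    · rintro ⟨⟨e, y⟩, h⟩
      refine ⟨(e, ⟨y, ?_⟩), congrArg Prod.fst h⟩
      rw [LinearMap.mem_ker, ← hj e y, h]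
  have hE : IsDivisible γ.range := hE₂.of_surjective _ γ.rangeRestrict_surjective
  set t := Module.finrank ℤ j.ker
  have hcard (p : ℕ) (hp : p.Prime) :
      Nat.card (torsionOf γ.range p) * p ^ s₁ = p ^ (s₂ + t) := by
    have h1 := card_torsionOf_mul_card_torsionOf hE₂ k γ.rangeRestrict hk
      γ.rangeRestrict_surjective hkγ hp.pos
    obtain ⟨h2, h3⟩ := hE₁.index_multiplesOf_prod_mul (F := j.ker) hp.pos (hs₁ p hp)
    refine Nat.eq_of_mul_eq_mul_right (Nat.pos_of_ne_zero h3) ?_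
    rw [mul_right_comm, h1, hs₂ p hp, mul_assoc, h2, pow_add, mul_assoc]
  have hs₃ (p : ℕ) (hp : p.Prime) : Nat.card (torsionOf γ.range p) = p ^ (s₂ + t - s₁) := by
    refine Nat.eq_of_mul_eq_mul_right (pow_pos hp.pos s₁) ?_
    rw [hcard p hp, ← pow_add]
    congr 1
    omega
  let h : F₂ →ₗ[ℤ] C ⧸ γ.range :=
    ((QuotientAddGroup.mk' γ.range).comp (g.comp (AddMonoidHom.inr E₂ F₂))).toIntLinearMap
  have hh : Surjective h := by
    intro c
    obtain ⟨c, rfl⟩ := QuotientAddGroup.mk_surjective c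
    obtain ⟨⟨e, y⟩, rfl⟩ := hg c
    refine ⟨y, ?_⟩
    change QuotientAddGroup.mk (g (0, y)) = QuotientAddGroup.mk (g (e, y))
    rw [QuotientAddGroup.eq]
    refine ⟨e, ?_⟩
    change g (e, 0) = _
    rw [neg_add_eq_sub, ← map_sub]
    simp
  have hker : h.ker = j.range := by
    ext y
    rw [LinearMap.mem_ker]
    change QuotientAddGroup.mk (g (0, y)) = (0 : C ⧸ γ.range) ↔ _
    rw [QuotientAddGroup.eq_zero_iff]
    constructor
    · rintro ⟨e, he⟩
      change g (e, 0) = g (0, y) at he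
      have h0 : g (-e, y) = 0 := by
        rw [show ((-e, y) : E₂ × F₂) = (0, y) - (e, 0) by simp, map_sub, he, sub_self]
      obtain ⟨⟨a, b⟩, hab⟩ := (hmem _).1 h0
      exact ⟨b, by rw [← hj a b, hab]⟩
    · rintro ⟨b, rfl⟩
      refine ⟨-(f (0, b)).1, ?_⟩
      change g (-(f (0, b)).1, 0) = g (0, j b)
      rw [← sub_eq_zero, ← map_sub, hmem]
      refine ⟨-(0, b), ?_⟩
      rw [map_neg]
      refine Prod.ext (by simp) ?_
      rw [Prod.snd_neg, hj]
      simp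
  have : Module.Finite ℤ (C ⧸ γ.range) := Module.Finite.of_surjective h hh
  obtain ⟨e⟩ := hE.nonempty_addEquiv_prod γ.range.subtype (QuotientAddGroup.mk' γ.range)
    γ.range.subtype_injective (QuotientAddGroup.mk'_surjective _) (by simp)
  refine ⟨s₂ + t - s₁, Module.finrank ℤ (C ⧸ γ.range), t, Module.finrank ℤ j.range,
    hE.isMildWith hs₃ e, hs, by omega, (finrank_range_add_finrank_ker_int j).symm, ?_⟩
  rw [← finrank_range_add_finrank_ker_int h, hker, LinearMap.range_eq_top.2 hh, finrank_top]

/-- Given a short exact sequence `0 → A → B → C → 0` of abelian groups with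
`A` and `B` mild (with invariants `s(A) = sA, r(A) = rA` and `s(B) = sB, r(B) = rB`),
the group `C` is mild, and its invariants `sC, rC` satisfy
`rC ≤ rB ≤ rA + rC`, `sA ≤ sB ≤ sA + sC` and `(rA + rC) - rB = (sA + sC) - sB`. -/
theorem isMild_of_shortExact_and_invariant_relations
    {A B C : Type u} [AddCommGroup A] [AddCommGroup B] [AddCommGroup C]
    (f : A →+ B) (g : B →+ C)
    (hf : Function.Injective f) (hg : Function.Surjective g) (hex : f.range = g.ker)
    (sA rA sB rB : ℕ) (hA : IsMildWith A sA rA) (hB : IsMildWith B sB rB) :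
    ∃ sC rC : ℕ, IsMildWith C sC rC ∧
      rC ≤ rB ∧ rB ≤ rA + rC ∧
      sA ≤ sB ∧ sB ≤ sA + sC ∧
      (rA : ℤ) + rC - rB = (sA : ℤ) + sC - sB := by
  obtain ⟨E₁, F₁, _, _, hE₁, hs₁, _, rfl, -, ⟨a⟩⟩ := hA.exists_addEquiv
  obtain ⟨E₂, F₂, _, _, hE₂, hs₂, _, rfl, hF₂, ⟨b⟩⟩ := hB.exists_addEquiv
  obtain ⟨s, r, t, j, hC, h₁, h₂, h₃, h₄⟩ :=
    exists_isMildWith_of_decomposition hE₁ hE₂ hs₁ hs₂ hF₂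
      (b.toAddMonoidHom.comp (f.comp a.symm.toAddMonoidHom)) (g.comp b.symm.toAddMonoidHom)
      (b.injective.comp (hf.comp a.symm.injective)) (hg.comp b.symm.surjective) (by
        ext x
        rw [AddMonoidHom.mem_ker]
        change (∃ y, b (f (a.symm y)) = x) ↔ g (b.symm x) = 0
        rw [← AddMonoidHom.mem_ker, ← hex]
        constructor
        · rintro ⟨y, rfl⟩
          exact ⟨a.symm y, by simp⟩
        · rintro ⟨y, hy⟩
          exact ⟨a y, by simp [hy]⟩)
  exact ⟨s, r, hC, by omega, by omega, h₁, by omega, by omega⟩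
end
end

section
/- An abelian group G is mild if and only if there exist a ℚ-vector space V and an additive group homomorphism f: V → G such that the kernel of f and the cokernel of f are finitely generated abelian groups. -/
noncomputable section

universe u v

/-- The rational vector space structure on a uniquely divisible abelian group. -/
@[reducible] def IsUniquelyDivisible.module {V : Type*} [AddCommGroup V]
    (hV : IsUniquelyDivisible V) : Module ℚ V :=
  haveI : IsLocalizedModule (nonZeroDivisors ℤ) (LinearMap.id : V →ₗ[ℤ] V) :=
    { map_units := by
        rintro ⟨n, hn⟩
        have hn0 : n ≠ 0 := nonZeroDivisors.ne_zero hn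
        rw [Module.End.isUnit_iff]
        change Function.Bijective fun v : V => n • v
        obtain ⟨m, rfl | rfl⟩ := Int.eq_nat_or_neg n
        all_goals
          have hb : Function.Bijective fun v : V => m • v :=
            (Function.bijective_iff_existsUnique _).2 fun v => hV v m (by omega)
        · simpa using hb
        · simpa [Function.comp_def] using (Equiv.neg V).bijective.comp hb
      surj := fun v => ⟨(v, 1), by simp⟩
      exists_of_eq := fun h => ⟨1, by simpa using h⟩ }
  IsLocalizedModule.module (A := ℚ) (nonZeroDivisors ℤ) (LinearMap.id : V →ₗ[ℤ] V)

lemma isUniquelyDivisible_of_module (V : Type*) [AddCommGroup V] [Module ℚ V] :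
    IsUniquelyDivisible V := by
  intro v n hn
  have hn' : (n : ℚ) ≠ 0 := by positivity
  refine ⟨(n : ℚ)⁻¹ • v, ?_, ?_⟩
  · simp only [← Nat.cast_smul_eq_nsmul ℚ n, smul_inv_smul₀ hn']
  · rintro w rfl
    rw [← Nat.cast_smul_eq_nsmul ℚ n, inv_smul_smul₀ hn']

/-- The image of a rational vector space is a direct summand of any abelian group. -/
lemma nonempty_addEquiv_range_prod_quotient {V G : Type*} [AddCommGroup V] [Module ℚ V]
    [AddCommGroup G] (f : V →+ G) : Nonempty (G ≃+ f.range × G ⧸ f.range) := by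
  let : DivisibleBy f.range ℤ := divisibleByOfSMulRightSurj _ _ fun {n} hn => by
    rintro ⟨_, v, rfl⟩
    have hn' : (n : ℚ) ≠ 0 := by exact_mod_cast hn
    refine ⟨⟨f ((n : ℚ)⁻¹ • v), _, rfl⟩, Subtype.ext ?_⟩
    change n • f ((n : ℚ)⁻¹ • v) = f v
    rw [← map_zsmul, ← Int.cast_smul_eq_zsmul ℚ, smul_inv_smul₀ hn']
  obtain ⟨p, hp⟩ := (Module.Baer.of_divisible f.range).extension_property_addMonoidHom
    f.range.subtype Subtype.coe_injective (AddMonoidHom.id _)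
  have hp' (x : f.range) : p x = x := DFunLike.congr_fun hp x
  refine ⟨AddEquiv.ofBijective (p.prod (QuotientAddGroup.mk' f.range)) ⟨?_, ?_⟩⟩
  · rw [injective_iff_map_eq_zero]
    intro g hg
    obtain ⟨h₁, h₂⟩ := Prod.ext_iff.1 hg
    have hm : g ∈ f.range := (QuotientAddGroup.eq_zero_iff g).1 h₂
    have := hp' ⟨g, hm⟩
    exact congrArg Subtype.val (this.symm.trans h₁)
  · rintro ⟨d, c⟩
    obtain ⟨g, rfl⟩ := QuotientAddGroup.mk'_surjective _ c
    refine ⟨g + ↑(d - p g), Prod.ext ?_ ?_⟩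
    · change p (g + ↑(d - p g)) = d
      rw [map_add, hp', add_sub_cancel]
    · exact (QuotientAddGroup.mk_add_of_mem g (d - p g).2)

/-- The quotient of a rational vector space by a finitely generated subgroup is the product of
a rational vector space and a finite power of `ℚ/ℤ`. -/
lemma exists_quotient_addEquiv_prod_qmodZ {V : Type u} [AddCommGroup V] [Module ℚ V]
    (K : AddSubgroup V) (hK : AddGroup.FG K) :
    ∃ (s : ℕ) (W : Submodule ℚ V), Nonempty (V ⧸ K ≃+ W × (Fin s → QmodZ)) := by
  have : Module.Finite ℤ K := Module.Finite.iff_addGroup_fg.2 hK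
  have : Module.IsTorsionFree ℤ V := Module.IsTorsionFree.trans_faithfulSMul ℤ ℚ V
  have : Module.IsTorsionFree ℤ K :=
    Function.Injective.moduleIsTorsionFree (Subtype.val : K → V) Subtype.coe_injective
      fun _ _ => rfl
  obtain ⟨s, b⟩ := Module.basisOfFiniteTypeTorsionFree' (R := ℤ) (M := K)
  let L : (Fin s → ℚ) →ₗ[ℚ] V := Fintype.linearCombination ℚ fun i => (b i : V)
  have hli : LinearIndependent ℚ fun i => (b i : V) := by
    rw [← LinearIndependent.iff_fractionRing ℤ ℚ]
    exact b.linearIndependent.map' K.subtype.toIntLinearMap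
      (LinearMap.ker_eq_bot.2 Subtype.coe_injective)
  obtain ⟨c, hc⟩ := L.exists_leftInverse_of_injective
    (LinearMap.ker_eq_bot.2 (linearIndependent_iff_injective_fintypeLinearCombination.1 hli))
  have hc' (x : Fin s → ℚ) : c (L x) = x := LinearMap.congr_fun hc x
  let q : ℚ →+ QmodZ := QuotientAddGroup.mk' _
  have hq : Function.Surjective q := QuotientAddGroup.mk'_surjective _
  have hq0 (x : ℚ) : q x = 0 ↔ ∃ n : ℤ, (n : ℚ) = x := by
    rw [show q x = (x : QmodZ) from rfl, AddCircle.coe_eq_zero_iff]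
    simp
  have hcoe (n : Fin s → ℤ) : L (fun i => (n i : ℚ)) = ((∑ i, n i • b i : K) : V) := by
    simp [L, Fintype.linearCombination_apply, Int.cast_smul_eq_zsmul]
  let π : V →ₗ[ℚ] LinearMap.ker c :=
    (LinearMap.id - L ∘ₗ c).codRestrict _ fun v => by simp [hc']
  have hπ (v : V) : (π v : V) = v - L (c v) := rfl
  let φ : V →+ LinearMap.ker c × (Fin s → QmodZ) :=
    π.toAddMonoidHom.prod ((q.compLeft (Fin s)).comp c.toAddMonoidHom)
  have hφ (v : V) : φ v = (π v, fun i => q (c v i)) := rfl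
  have hsurj : Function.Surjective φ := by
    rintro ⟨w, y⟩
    choose x hx using fun i => hq (y i)
    have hw : c w = 0 := w.2
    refine ⟨w + L x, ?_⟩
    rw [hφ]
    refine Prod.ext (Subtype.ext ?_) (funext fun i => ?_)
    · simp [hπ, hc', hw]
    · simp [hc', hw, hx]
  have hker : φ.ker = K := by
    ext v
    rw [AddMonoidHom.mem_ker, hφ, Prod.mk_eq_zero]
    constructor
    · rintro ⟨h₁, h₂⟩
      choose n hn using fun i => (hq0 (c v i)).1 (congrFun h₂ i)
      have hv : v = L (c v) := sub_eq_zero.1 (congrArg Subtype.val h₁)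
      rw [hv, ← funext hn, hcoe]
      exact Subtype.property _
    · intro hv
      have hv' : v = L fun i => (b.repr ⟨v, hv⟩ i : ℚ) := by
        rw [hcoe, b.sum_repr]
      rw [hv']
      refine ⟨Subtype.ext ?_, funext fun i => ?_⟩
      · simp [hπ, hc']
      · rw [hc']
        exact (hq0 _).2 ⟨_, rfl⟩
  exact ⟨s, LinearMap.ker c, ⟨(QuotientAddGroup.quotientAddEquivOfEq hker.symm).trans
    (QuotientAddGroup.quotientKerEquivOfSurjective φ hsurj)⟩⟩

lemma exists_addEquiv_prod_finite (C : Type u) [AddCommGroup C] [AddGroup.FG C] :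
    ∃ (r : ℕ) (T : Type u) (_ : AddCommGroup T),
      Finite T ∧ Nonempty (C ≃+ (Fin r → ℤ) × T) := by
  classical
  obtain ⟨r, ι, _, p, hp, e, ⟨E⟩⟩ := AddCommGroup.equiv_free_prod_directSum_zmod C
  have (i : ι) : NeZero (p i ^ e i) := ⟨pow_ne_zero _ (hp i).ne_zero⟩
  exact ⟨r, ULift.{u} (∀ i, ZMod (p i ^ e i)), inferInstance, inferInstance,
    ⟨E.trans (Finsupp.addEquivFunOnFinite.prodCongr
      ((DirectSum.addEquivProd _).trans AddEquiv.ulift.symm))⟩⟩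

lemma IsMild.exists_presentation {G : Type u} [AddCommGroup G] (hG : IsMild G) :
    ∃ (V : Type u) (_ : AddCommGroup V) (_ : Module ℚ V) (f : V →+ G),
      AddGroup.FG f.ker ∧ AddGroup.FG (G ⧸ f.range) := by
  obtain ⟨s, r, V, T, _, _, hV, _, ⟨e⟩⟩ := hG
  let := hV.module
  let q : ℚ →+ QmodZ := QuotientAddGroup.mk' _
  have hq : Function.Surjective q := QuotientAddGroup.mk'_surjective _
  have hq0 (x : ℚ) : q x = 0 ↔ ∃ n : ℤ, (n : ℚ) = x := by
    rw [show q x = (x : QmodZ) from rfl, AddCircle.coe_eq_zero_iff]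
    simp
  let j : V × (Fin s → ℚ) →+ V × (Fin s → QmodZ) × (Fin r → ℤ) × T :=
    (AddMonoidHom.id V).prodMap ((AddMonoidHom.inl _ _).comp (q.compLeft (Fin s)))
  have hj (v : V) (x : Fin s → ℚ) : j (v, x) = (v, fun i => q (x i), 0, 0) := rfl
  let f : V × (Fin s → ℚ) →+ G := e.symm.toAddMonoidHom.comp j
  have hf (y) : f y = e.symm (j y) := rfl
  refine ⟨V × (Fin s → ℚ), inferInstance, inferInstance, f, ?_, ?_⟩
  · let k : (Fin s → ℤ) →+ f.ker :=
      ((AddMonoidHom.inr V _).comp ((Int.castAddHom ℚ).compLeft (Fin s))).codRestrict f.ker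
        fun n => by
          change f (0, fun i => (n i : ℚ)) = 0
          have : (fun i => q (n i)) = 0 := funext fun i => (hq0 _).2 ⟨_, rfl⟩
          rw [hf, hj, this]
          exact map_zero _
    have : AddGroup.FG (Fin s → ℤ) := Module.Finite.iff_addGroup_fg.1 inferInstance
    refine AddGroup.fg_of_surjective (f := k) ?_
    rintro ⟨⟨v, x⟩, hx⟩
    have hx' : j (v, x) = 0 := e.symm.map_eq_zero_iff.1 hx
    rw [hj] at hx'
    simp only [Prod.mk_eq_zero, and_true] at hx'
    obtain ⟨rfl, h⟩ := hx'
    choose n hn using fun i => (hq0 (x i)).1 (congrFun h i)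
    exact ⟨n, Subtype.ext (Prod.ext rfl (funext hn))⟩
  · let k : (Fin r → ℤ) × T →+ G ⧸ f.range :=
      (QuotientAddGroup.mk' f.range).comp (e.symm.toAddMonoidHom.comp
        ((AddMonoidHom.inr V _).comp (AddMonoidHom.inr _ _)))
    have : AddGroup.FG ((Fin r → ℤ) × T) := Module.Finite.iff_addGroup_fg.1 inferInstance
    refine AddGroup.fg_of_surjective (f := k) ?_
    intro c
    obtain ⟨g, rfl⟩ := QuotientAddGroup.mk'_surjective _ c
    obtain ⟨⟨v, y, z⟩, rfl⟩ := e.symm.surjective g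
    choose x hx using fun i => hq (y i)
    refine ⟨z, (QuotientAddGroup.eq (s := f.range)).2 ⟨(v, x), ?_⟩⟩
    change e.symm (j (v, x)) = -e.symm (0, 0, z) + e.symm (v, y, z)
    rw [← map_neg, ← map_add, hj, funext hx]
    congr 1
    ext <;> simp

lemma isMild_of_presentation {G : Type u} [AddCommGroup G] {V : Type u} [AddCommGroup V]
    [Module ℚ V] (f : V →+ G) (hker : AddGroup.FG f.ker) (hcoker : AddGroup.FG (G ⧸ f.range)) :
    IsMild G := by
  obtain ⟨s, W, ⟨E⟩⟩ := exists_quotient_addEquiv_prod_qmodZ f.ker hker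
  obtain ⟨r, T, _, hT, ⟨F⟩⟩ := exists_addEquiv_prod_finite (G ⧸ f.range)
  obtain ⟨S⟩ := nonempty_addEquiv_range_prod_quotient f
  exact ⟨s, r, W, T, inferInstance, inferInstance, isUniquelyDivisible_of_module W, hT,
    ⟨S.trans ((((QuotientAddGroup.quotientKerEquivRange f).symm.trans E).prodCongr F).trans
      AddEquiv.prodAssoc)⟩⟩

/-- An abelian group `G` is mild if and only if there exist a `ℚ`-vector
space `V` and a group homomorphism `f : V → G` whose kernel and cokernel are finitely
generated. -/
theorem isMild_iff_exists_presentation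
    {G : Type u} [AddCommGroup G] :
    IsMild G ↔
      ∃ (V : Type u) (_ : AddCommGroup V) (_ : Module ℚ V) (f : V →+ G),
        AddGroup.FG f.ker ∧ AddGroup.FG (G ⧸ f.range) := by
  exact ⟨IsMild.exists_presentation, fun ⟨_, _, _, f, hker, hcoker⟩ =>
    isMild_of_presentation f hker hcoker⟩
end
end

section
/- The abelian group ∏_p ℤ_p, the product over all primes p of the additive groups of p-adic integers, is not a mild abelian group. -/
noncomputable section

universe u v

instance (p : Nat.Primes) : Fact (p : ℕ).Prime := ⟨p.2⟩

theorem PadicInt.divisibleSubgroup_eq_bot (p : ℕ) [Fact p.Prime] :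
    divisibleSubgroup ℤ_[p] = ⊥ := by
  refine (AddSubgroup.eq_bot_iff_forall _).2 fun x hx => ?_
  by_contra hx0
  obtain ⟨n, hn⟩ := FiniteMultiplicity.of_not_isUnit (PadicInt.prime_p (p := p)).not_isUnit hx0
  obtain ⟨y, hy⟩ := hx (p ^ (n + 1)) (pow_pos (Fact.out : p.Prime).pos _)
  exact hn ⟨y, by rw [← hy, nsmul_eq_mul, Nat.cast_pow]⟩

theorem IsUniquelyDivisible.divisibleSubgroup_eq_top {V : Type*} [AddCommGroup V]
    (hV : IsUniquelyDivisible V) : divisibleSubgroup V = ⊤ :=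
  eq_top_iff.2 fun v _ n hn => (hV v n hn).exists

theorem map_mem_divisibleSubgroup {G H : Type*} [AddCommGroup G] [AddCommGroup H] (f : G →+ H)
    {g : G} (hg : g ∈ divisibleSubgroup G) : f g ∈ divisibleSubgroup H := by
  intro n hn
  obtain ⟨h, rfl⟩ := hg n hn
  exact ⟨f h, (map_nsmul f n h).symm⟩

theorem divisibleSubgroup_pi_eq_bot {ι : Type*} {G : ι → Type*} [∀ i, AddCommGroup (G i)]
    (h : ∀ i, divisibleSubgroup (G i) = ⊥) : divisibleSubgroup (∀ i, G i) = ⊥ := by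
  refine (AddSubgroup.eq_bot_iff_forall _).2 fun x hx => funext fun i => ?_
  have hi := map_mem_divisibleSubgroup (Pi.evalAddMonoidHom G i) hx
  rwa [h i] at hi

/-- A mild group without nonzero divisible elements is countable. -/
theorem IsMild.countable_of_divisibleSubgroup_eq_bot {G : Type u} [AddCommGroup G]
    (hG : IsMild G) (h : divisibleSubgroup G = ⊥) : Countable G := by
  obtain ⟨s, r, V, T, _, _, hV, _, ⟨e⟩⟩ := hG
  have : Subsingleton V := by
    refine subsingleton_of_forall_eq 0 fun v => ?_
    have hv := map_mem_divisibleSubgroup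
      (e.symm.toAddMonoidHom.comp (AddMonoidHom.inl V ((Fin s → QmodZ) × (Fin r → ℤ) × T)))
      (hV.divisibleSubgroup_eq_top ▸ AddSubgroup.mem_top v)
    rw [h, AddSubgroup.mem_bot] at hv
    simpa using hv
  have : Countable QmodZ := (QuotientAddGroup.mk_surjective (s := AddSubgroup.zmultiples (1 : ℚ))).countable
  exact e.injective.countable

theorem uncountable_pi_of_nontrivial {ι : Type*} [Infinite ι] (X : ι → Type*)
    [∀ i, Nontrivial (X i)] : Uncountable (∀ i, X i) := by
  classical
  refine ⟨fun _ => ?_⟩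
  choose a b hab using fun i => exists_pair_ne (X i)
  have hinj : Function.Injective fun (S : Set ι) (i : ι) => if i ∈ S then a i else b i := by
    intro S S' hS
    ext i
    have hi := congrFun hS i
    by_cases h : i ∈ S <;> by_cases h' : i ∈ S' <;> simp_all [(hab i).symm]
  obtain ⟨f, hf⟩ := exists_injective_nat (∀ i, X i)
  exact Function.cantor_injective _
    ((Infinite.natEmbedding ι).injective.comp (hf.comp hinj))

/-- The abelian group `∏_p ℤ_p`, the product over all primes `p` of the
additive groups of `p`-adic integers, is not mild. -/
theorem prod_padicInt_not_isMild :
    ¬ IsMild (∀ p : Nat.Primes, ℤ_[p]) := by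
  intro h
  have hcount := h.countable_of_divisibleSubgroup_eq_bot
    (divisibleSubgroup_pi_eq_bot fun p => PadicInt.divisibleSubgroup_eq_bot p)
  exact (uncountable_pi_of_nontrivial fun p : Nat.Primes => ℤ_[p]).not_countable hcount
end
end
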